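/- Let g, r, d be integers with 0 < 2r ≤ d ≤ g - 1 and ρ(g,r,d) := g - (r+1)(g-d+r) < d - g < 0. Let C be a smooth projective curve of genus g and A a line bundle of degree d on C with h⁰(A) = r+1 (a complete g^r_d). Then there exists an r-dimensional subspace V ⊂ H⁰(A) such that the restricted Petri map μ_{0,V} : V ⊗ H⁰(ω_C ⊗ A^∨) → H⁰(ω_C) is non-injective. -/

import Mathlib

open Module

/-- A solution over an extension of an algebraically closed field specializes. -/
theorem petri_specialize {K L σ : Type*} [Field K] [IsAlgClosed K] [Field L] [Finite σ]
    (i : K →+* L) (p : σ → L) :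
    ∃ q : σ → K, ∀ P : MvPolynomial σ K, MvPolynomial.eval₂ i p P = 0 →
      MvPolynomial.eval q P = 0 := by
  obtain ⟨M, hM, hle⟩ := Ideal.exists_le_maximal
    (RingHom.ker (MvPolynomial.eval₂Hom i p)) (RingHom.ker_ne_top _)
  obtain ⟨q, hq⟩ := (MvPolynomial.isMaximal_iff_eq_vanishingIdeal_singleton).1 hM
  refine ⟨q, fun P hP => ?_⟩
  have h1 : P ∈ M := hle (by simpa [RingHom.mem_ker] using hP)
  rw [hq, MvPolynomial.mem_vanishingIdeal_iff] at h1
  simpa [MvPolynomial.aeval_def, MvPolynomial.eval₂_id] using h1 q rfl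

/-- If a valuation ring contains the values of the forms, but not some product,
we get a nontrivial solution. -/
theorem petri_of_valuation {K F : Type*} [Field K] [IsAlgClosed K] [Field F] [Algebra K F]
    {a k n : ℕ} (b : Fin a → Fin k → Fin n → K) (x : Fin a → F) (y : Fin k → F)
    (V : ValuationSubring F) (hK : ∀ c : K, algebraMap K F c ∈ V)
    (hf : ∀ l, ∑ i, ∑ j, algebraMap K F (b i j l) * (x i * y j) ∈ V)
    (i₁ : Fin a) (j₁ : Fin k) (h1 : x i₁ * y j₁ ∉ V) :
    ∃ (u : Fin a → K) (v : Fin k → K), u ≠ 0 ∧ v ≠ 0 ∧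
      ∀ l, ∑ i, ∑ j, b i j l * (u i * v j) = 0 := by
  classical
  haveI : Nonempty (Fin a) := ⟨i₁⟩
  haveI : Nonempty (Fin k) := ⟨j₁⟩
  obtain ⟨i₀, hi₀⟩ := Finite.exists_max (fun i => V.valuation (x i))
  obtain ⟨j₀, hj₀⟩ := Finite.exists_max (fun j => V.valuation (y j))
  have h0 : 1 < V.valuation (x i₀ * y j₀) := by
    have : 1 < V.valuation (x i₁ * y j₁) := by
      rw [← not_le, V.valuation_le_one_iff]; exact h1
    refine this.trans_le ?_
    rw [map_mul, map_mul]
    exact mul_le_mul' (hi₀ _) (hj₀ _)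
  have hxy : x i₀ * y j₀ ≠ 0 := by
    intro h; rw [h, map_zero] at h0; exact absurd h0 (by simp)
  have hx0 : x i₀ ≠ 0 := left_ne_zero_of_mul hxy
  have hy0 : y j₀ ≠ 0 := right_ne_zero_of_mul hxy
  have key : ∀ s t : F, t ≠ 0 → V.valuation s ≤ V.valuation t → s / t ∈ V := by
    intro s t ht hst
    rw [← V.valuation_le_one_iff, map_div₀]
    exact div_le_one_of_le₀ hst zero_le'
  let X : Fin a → V := fun i => ⟨x i / x i₀, key _ _ hx0 (hi₀ i)⟩
  let Y : Fin k → V := fun j => ⟨y j / y j₀, key _ _ hy0 (hj₀ j)⟩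
  let φ : K →+* V := (algebraMap K F).codRestrict V.toSubring hK
  let π : V →+* IsLocalRing.ResidueField V := IsLocalRing.residue V
  have hX : X i₀ = 1 := Subtype.ext (div_self hx0)
  have hY : Y j₀ = 1 := Subtype.ext (div_self hy0)
  have hl : ∀ l, π (∑ i, ∑ j, φ (b i j l) * (X i * Y j)) = 0 := by
    intro l
    rw [IsLocalRing.residue_eq_zero_iff, V.valuation_lt_one_iff]
    have e : ((∑ i, ∑ j, φ (b i j l) * (X i * Y j) : V) : F)
        = (∑ i, ∑ j, algebraMap K F (b i j l) * (x i * y j)) / (x i₀ * y j₀) := by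
      push_cast
      simp only [Finset.sum_div]
      refine Finset.sum_congr rfl fun i _ => Finset.sum_congr rfl fun j _ => ?_
      change algebraMap K F (b i j l) * (x i / x i₀ * (y j / y j₀)) = _
      field_simp
    rw [e, map_div₀]
    exact (div_lt_one₀ (zero_lt_one.trans h0)).2
      (((V.valuation_le_one_iff _).2 (hf l)).trans_lt h0)
  obtain ⟨q, hq⟩ := petri_specialize (π.comp φ)
    (Sum.elim (fun i => π (X i)) (fun j => π (Y j)))
  refine ⟨fun i => q (Sum.inl i), fun j => q (Sum.inr j), ?_, ?_, ?_⟩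
  · intro h
    have := hq (MvPolynomial.X (Sum.inl i₀) - 1) (by simp [hX])
    have h2 := congrFun h i₀
    simp [sub_eq_zero] at this h2
    simp [h2] at this
  · intro h
    have := hq (MvPolynomial.X (Sum.inr j₀) - 1) (by simp [hY])
    have h2 := congrFun h j₀
    simp [sub_eq_zero] at this h2
    simp [h2] at this
  · intro l
    have := hq (∑ i, ∑ j, MvPolynomial.C (b i j l) *
      (MvPolynomial.X (Sum.inl i) * MvPolynomial.X (Sum.inr j))) (by
        have := hl l
        simpa [map_sum, MvPolynomial.eval₂_sum] using this)
    simpa using this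

theorem petri_hopf_coords {K : Type*} [Field K] [IsAlgClosed K]
    {a k n : ℕ} (hk : 0 < k) (hn : n < a + k) (b : Fin (a + 1) → Fin k → Fin n → K) :
    ∃ (u : Fin (a + 1) → K) (v : Fin k → K), u ≠ 0 ∧ v ≠ 0 ∧
      ∀ l, ∑ i, ∑ j, b i j l * (u i * v j) = 0 := by
  classical
  let P := MvPolynomial (Fin a ⊕ Fin k) K
  let F := FractionRing P
  let x : Fin (a + 1) → F := Fin.cons 1 (fun i => algebraMap P F (MvPolynomial.X (Sum.inl i)))
  let y : Fin k → F := fun j => algebraMap P F (MvPolynomial.X (Sum.inr j))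
  let f : Fin n → F := fun l => ∑ i, ∑ j, algebraMap K F (b i j l) * (x i * y j)
  let R := Algebra.adjoin K (Set.range f)
  by_cases h : ∀ i j, IsIntegral R (x i * y j)
  · exfalso
    have hy : ∀ j, IsAlgebraic R (y j) := fun j => by
      simpa [x] using (h 0 j).isAlgebraic
    have hx : ∀ i, IsAlgebraic R (x i) := fun i => by
      have h1 := (h i ⟨0, hk⟩).isAlgebraic.mul (hy ⟨0, hk⟩).inv
      have h2 : y ⟨0, hk⟩ ≠ 0 := by
        simp only [y]
        rw [Ne, FaithfulSMul.algebraMap_eq_zero_iff]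
        exact MvPolynomial.X_ne_zero _
      rwa [mul_assoc, mul_inv_cancel₀ h2, mul_one] at h1
    have hp : ∀ p : P, IsAlgebraic R (algebraMap P F p) := by
      intro p
      induction p using MvPolynomial.induction_on with
      | C c =>
        have : algebraMap P F (MvPolynomial.C c) = algebraMap R F (algebraMap K R c) := by
          rw [← IsScalarTower.algebraMap_apply K R F, IsScalarTower.algebraMap_apply K P F]
          rfl
        rw [this]
        exact isAlgebraic_algebraMap _
      | add p q hp hq => rw [map_add]; exact hp.add hq
      | mul_X p i hp =>
        rw [map_mul]
        refine hp.mul ?_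
        rcases i with i | j
        · simpa [x] using hx i.succ
        · exact hy j
    haveI : Algebra.IsAlgebraic R F := ⟨fun z => by
      obtain ⟨p, q, -, rfl⟩ := IsFractionRing.div_surjective (A := P) z
      rw [div_eq_mul_inv]
      exact (hp p).mul (hp q).inv⟩
    have h1 := Algebra.IsAlgebraic.trdeg_le_cardinalMk K (Set.range f)
    have hX : AlgebraicIndependent K (fun i : Fin a ⊕ Fin k => algebraMap P F (MvPolynomial.X i)) :=
      (MvPolynomial.algebraicIndependent_X (Fin a ⊕ Fin k) K).map'
        (f := IsScalarTower.toAlgHom K P F) (IsFractionRing.injective P F)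
    have h2 := hX.lift_cardinalMk_le_trdeg
    have h3 : Cardinal.mk (Set.range f) ≤ n := by
      have := Cardinal.mk_range_le_lift (f := f)
      simpa using this
    have h4 := h1.trans h3
    have h5 : ((a + k : ℕ) : Cardinal) ≤ n := by
      refine le_trans ?_ h4
      simpa using h2
    exact absurd (Nat.cast_le.1 h5) (by omega)
  · push Not at h
    obtain ⟨i, j, hij⟩ := h
    let S : Subring F := (integralClosure R F).toSubring
    haveI : IsIntegrallyClosedIn S F :=
      inferInstanceAs (IsIntegrallyClosedIn (integralClosure R F) F)
    obtain ⟨V, hV, hV'⟩ := Subring.exists_le_valuationSubring_of_isIntegrallyClosedIn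
      (R := S) (x := x i * y j) hij
    have hR : ∀ z : R, (z : F) ∈ V := fun z => hV ((integralClosure R F).algebraMap_mem z)
    exact petri_of_valuation b x y V (fun c => hR (algebraMap K R c))
      (fun l => hR ⟨f l, Algebra.subset_adjoin ⟨l, rfl⟩⟩) i j hV'

theorem petri_hopf {K : Type*} [Field K] [IsAlgClosed K] {P W B : Type*}
    [AddCommGroup P] [Module K P] [FiniteDimensional K P]
    [AddCommGroup W] [Module K W] [FiniteDimensional K W]
    [AddCommGroup B] [Module K B] [FiniteDimensional K B]
    (hP : 0 < finrank K P) (hW : 0 < finrank K W)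
    (hd : finrank K B + 2 ≤ finrank K P + finrank K W) (β : P →ₗ[K] W →ₗ[K] B) :
    ∃ p w, p ≠ 0 ∧ w ≠ 0 ∧ β p w = 0 := by
  obtain ⟨a, ha⟩ : ∃ a, finrank K P = a + 1 := ⟨finrank K P - 1, by omega⟩
  let eP := finBasisOfFinrankEq K P ha
  let eW := finBasis K W
  let eB := finBasis K B
  obtain ⟨u, v, hu, hv, h⟩ := petri_hopf_coords hW (n := finrank K B) (a := a) (by omega)
    (fun i j l => eB.repr (β (eP i) (eW j)) l)
  refine ⟨∑ i, u i • eP i, ∑ j, v j • eW j, ?_, ?_, ?_⟩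
  · intro h0
    exact hu (funext (Fintype.linearIndependent_iff.1 eP.linearIndependent u h0))
  · intro h0
    exact hv (funext (Fintype.linearIndependent_iff.1 eW.linearIndependent v h0))
  · apply eB.ext_elem
    intro l
    rw [map_zero, Finsupp.zero_apply, ← h l]
    simp only [map_sum, map_smul, LinearMap.sum_apply, LinearMap.smul_apply, Finsupp.coe_finset_sum,
      Finset.sum_apply, Finsupp.smul_apply, smul_eq_mul, Finset.smul_sum, Finset.mul_sum]
    first
    | (refine Finset.sum_congr rfl fun i _ => Finset.sum_congr rfl fun j _ => ?_
       ring)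
    | (rw [Finset.sum_comm]
       refine Finset.sum_congr rfl fun i _ => Finset.sum_congr rfl fun j _ => ?_
       ring)

/-- Let `g, r, d` be integers with `0 < 2r ≤ d ≤ g - 1` and
`ρ(g,r,d) = g - (r+1)(g-d+r) < d - g < 0`.  Let `C` be a smooth projective curve of genus
`g` over an algebraically closed field and `A` a line bundle of degree `d` on `C` with
`h⁰(A) = r + 1` (a complete `g^r_d`).  Here `H0A = H⁰(A)`, `H0B = H⁰(ω_C ⊗ A^∨)` (whose
dimension is `g - d + r` by Riemann–Roch), `H0ω = H⁰(ω_C)` (of dimension `g`), and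
`μ : H⁰(A) ⊗ H⁰(ω_C ⊗ A^∨) → H⁰(ω_C)` is the Petri map.  Then there exists an
`r`-dimensional subspace `V ⊂ H⁰(A)` such that the restricted Petri map
`μ_{0,V} : V ⊗ H⁰(ω_C ⊗ A^∨) → H⁰(ω_C)` is non-injective. -/
theorem stmt_9 (K : Type*) [Field K] [IsAlgClosed K]
    (g r d : ℤ) (hr : 0 < 2 * r) (hrd : 2 * r ≤ d) (hdg : d ≤ g - 1)
    (hρ : g - (r + 1) * (g - d + r) < d - g) (hdg' : d - g < 0)
    (H0A H0B H0ω : Type*)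
    [AddCommGroup H0A] [Module K H0A] [FiniteDimensional K H0A]
    [AddCommGroup H0B] [Module K H0B] [FiniteDimensional K H0B]
    [AddCommGroup H0ω] [Module K H0ω] [FiniteDimensional K H0ω]
    (hA : (finrank K H0A : ℤ) = r + 1)
    (hB : (finrank K H0B : ℤ) = g - d + r)
    (hω : (finrank K H0ω : ℤ) = g)
    (μ : TensorProduct K H0A H0B →ₗ[K] H0ω) :
    ∃ V : Submodule K H0A, (finrank K V : ℤ) = r ∧
      ¬ Function.Injective
        (μ ∘ₗ TensorProduct.map V.subtype (LinearMap.id : H0B →ₗ[K] H0B)) := by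
  have hker := LinearMap.finrank_range_add_finrank_ker μ
  have hrange := Submodule.finrank_le (LinearMap.range μ)
  rw [finrank_tensorProduct] at hker
  have hker' : (finrank K (LinearMap.range μ) : ℤ) + finrank K (LinearMap.ker μ)
      = (r + 1) * (g - d + r) := by
    rw [← hA, ← hB]; exact_mod_cast hker
  have hD : finrank K (Module.Dual K H0A) = finrank K H0A := Subspace.dual_finrank_eq
  let β : Module.Dual K H0A →ₗ[K] LinearMap.ker μ →ₗ[K] H0B :=
    (LinearMap.llcomp K (LinearMap.ker μ) (TensorProduct K H0A H0B) H0B).flip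
        (LinearMap.ker μ).subtype ∘ₗ
      (LinearMap.llcomp K (TensorProduct K H0A H0B) (TensorProduct K K H0B) H0B
        (TensorProduct.lid K H0B).toLinearMap) ∘ₗ LinearMap.rTensorHom H0B
  obtain ⟨φ, w, hφ, hw, h0⟩ := petri_hopf (by omega) (by omega) (by omega) β
  have h0' : LinearMap.rTensor H0B φ (w : TensorProduct K H0A H0B) = 0 := by
    have : TensorProduct.lid K H0B (LinearMap.rTensor H0B φ w) = 0 := h0
    simpa using this
  have hsurj : Function.Surjective φ := LinearMap.surjective hφ
  have hex := rTensor_exact H0B (LinearMap.exact_subtype_ker_map φ) hsurj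
  obtain ⟨t, ht⟩ := (hex _).1 h0'
  refine ⟨LinearMap.ker φ, ?_, ?_⟩
  · have h1 := LinearMap.finrank_range_add_finrank_ker φ
    rw [LinearMap.range_eq_top.2 hsurj, finrank_top, finrank_self] at h1
    omega
  · intro hinj
    have ht' : TensorProduct.map (LinearMap.ker φ).subtype (LinearMap.id : H0B →ₗ[K] H0B) t
        = (w : TensorProduct K H0A H0B) := ht
    have h1 : t = 0 := by
      apply hinj
      rw [map_zero, LinearMap.comp_apply, ht']
      exact w.2
    rw [h1, map_zero] at ht
    exact hw (Subtype.ext ht.symm)
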